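/- Let n ≥ 1, s ≥ 1 and suppose q_n^s = Σ_{k=1}^{T_{n,s}} (a_k·x)^{2s} is a tight Waring decomposition with a_1,…,a_{T_{n,s}} ∈ ℂ^n, where T_{n,s} = binom(s+n−1, s). Then the decomposition is first caliber; in particular, (a_k·a_k)^s = (1/T_{n,s}) · ∏_{j=0}^{s−1} (2j+n)/(2j+1) for every k. -/

import Mathlib

open MvPolynomial

noncomputable def qpoly (n : ℕ) : MvPolynomial (Fin n) ℂ :=
  ∑ i : Fin n, X i ^ 2

noncomputable def linForm {n : ℕ} (a : Fin n → ℂ) : MvPolynomial (Fin n) ℂ :=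
  ∑ i : Fin n, C (a i) * X i

noncomputable def dotC {n : ℕ} (a b : Fin n → ℂ) : ℂ :=
  ∑ i : Fin n, a i * b i

noncomputable def diffOp {n : ℕ} (φ f : MvPolynomial (Fin n) ℂ) : MvPolynomial (Fin n) ℂ :=
  ∑ d ∈ φ.support, φ.coeff d •
    ((List.ofFn fun i : Fin n =>
        ((pderiv i).toLinearMap : MvPolynomial (Fin n) ℂ →ₗ[ℂ] MvPolynomial (Fin n) ℂ) ^ d i).prod f)

noncomputable def lap {n : ℕ} (f : MvPolynomial (Fin n) ℂ) : MvPolynomial (Fin n) ℂ :=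
  ∑ i : Fin n, pderiv i (pderiv i f)

/-! ### Elementary evaluations -/

lemma eval_linForm {n : ℕ} (a x : Fin n → ℂ) : eval x (linForm a) = dotC a x := by
  simp [linForm, dotC]

lemma eval_qpoly {n : ℕ} (x : Fin n → ℂ) : eval x (qpoly n) = dotC x x := by
  simp [qpoly, dotC, sq]

lemma dotC_add_smul {n : ℕ} (a x b : Fin n → ℂ) (t : ℂ) :
    dotC a (x + t • b) = dotC a x + dotC a b * t := by
  simp only [dotC, Pi.add_apply, Pi.smul_apply, smul_eq_mul, Finset.sum_mul,
    ← Finset.sum_add_distrib]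
  exact Finset.sum_congr rfl fun i _ => by ring

lemma dotC_comm {n : ℕ} (a b : Fin n → ℂ) : dotC a b = dotC b a := by
  simp [dotC, mul_comm]

lemma dotC_self_add_smul {n : ℕ} (x b : Fin n → ℂ) (t : ℂ) :
    dotC (x + t • b) (x + t • b) = dotC x x + t * (2 * dotC b x + dotC b b * t) := by
  rw [dotC_add_smul, dotC_comm _ x, dotC_comm _ b, dotC_add_smul, dotC_add_smul, dotC_comm x b]
  ring

/-! ### The Laplacian -/

lemma lap_sum {n : ℕ} {ι : Type*} (t : Finset ι) (f : ι → MvPolynomial (Fin n) ℂ) :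
    lap (∑ k ∈ t, f k) = ∑ k ∈ t, lap (f k) := by
  simp only [lap, map_sum]
  exact Finset.sum_comm

lemma lap_C_mul {n : ℕ} (c : ℂ) (f : MvPolynomial (Fin n) ℂ) :
    lap (C c * f) = C c * lap f := by
  simp [lap, Finset.mul_sum]

lemma pderiv_linForm {n : ℕ} (a : Fin n → ℂ) (i : Fin n) : pderiv i (linForm a) = C (a i) := by
  simp [linForm, pderiv_X, Pi.single_apply]

lemma pderiv_qpoly {n : ℕ} (i : Fin n) : pderiv i (qpoly n) = 2 * X i := by
  simp [qpoly, pderiv_X, Pi.single_apply]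

lemma pderiv_two {n : ℕ} (i : Fin n) : pderiv i (2 : MvPolynomial (Fin n) ℂ) = 0 := by
  simpa using (pderiv i).map_natCast 2

lemma lap_linForm_pow {n : ℕ} (a : Fin n → ℂ) (r : ℕ) :
    lap (linForm a ^ (2 * (r + 1))) =
      C ((2 * r + 2) * (2 * r + 1) * dotC a a) * linForm a ^ (2 * r) := by
  have h (i : Fin n) : pderiv i (pderiv i (linForm a ^ (2 * (r + 1)))) =
      C ((2 * r + 2) * (2 * r + 1) * (a i * a i)) * linForm a ^ (2 * r) := by
    rw [show 2 * (r + 1) = 2 * r + 1 + 1 by ring]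
    have hC : (C 2 : MvPolynomial (Fin n) ℂ) = 2 := map_ofNat C 2
    simp [pderiv_linForm, pderiv_two, hC]
    ring
  simp only [lap, h, ← Finset.sum_mul, ← map_sum, ← Finset.mul_sum, dotC]

lemma lap_qpoly_pow (n r : ℕ) :
    lap (qpoly n ^ (r + 1)) = C ((2 * (r : ℂ) + 2) * (2 * r + n)) * qpoly n ^ r := by
  have h (i : Fin n) : pderiv i (pderiv i (qpoly n ^ (r + 1))) =
      4 * (r : MvPolynomial (Fin n) ℂ) * ((r : MvPolynomial (Fin n) ℂ) + 1) *
        qpoly n ^ (r - 1) * X i ^ 2 + 2 * ((r : MvPolynomial (Fin n) ℂ) + 1) * qpoly n ^ r := by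
    simp [pderiv_qpoly, pderiv_two]
    ring
  have hq : (r : MvPolynomial (Fin n) ℂ) * (qpoly n ^ (r - 1) * qpoly n) = r * qpoly n ^ r := by
    cases r with
    | zero => simp
    | succ r => simp [pow_succ]
  simp only [lap, h, Finset.sum_add_distrib, ← Finset.mul_sum]
  rw [show ∑ i : Fin n, (X i : MvPolynomial (Fin n) ℂ) ^ 2 = qpoly n from rfl]
  have hC : (C 2 : MvPolynomial (Fin n) ℂ) = 2 := map_ofNat C 2
  simp [hC]
  linear_combination 4 * (r + 1) * hq

/-- Applying the Laplacian `i` times to a decomposition of `q_n ^ (r + i)`. -/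
lemma sum_dotC_pow_mul_linForm_pow {n : ℕ} {ι : Type*} [Fintype ι] (a : ι → Fin n → ℂ) (i : ℕ) :
    ∀ r : ℕ, qpoly n ^ (r + i) = ∑ k, linForm (a k) ^ (2 * (r + i)) →
      ∑ k, C (dotC (a k) (a k) ^ i) * linForm (a k) ^ (2 * r) =
        C (∏ j ∈ Finset.range i, ((2 * ((r + j : ℕ) : ℂ) + n) / (2 * ((r + j : ℕ) : ℂ) + 1))) *
          qpoly n ^ r := by
  induction i with
  | zero => intro r h; simpa using h.symm
  | succ i ih =>
    intro r h
    have h1 := congrArg lap (ih (r + 1) (by rw [show r + 1 + i = r + (i + 1) by ring]; exact h))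
    simp only [lap_sum, lap_C_mul, lap_linForm_pow, lap_qpoly_pow] at h1
    have e1 : (2 * (r : ℂ) + 2) ≠ 0 := by exact_mod_cast (by omega : 2 * r + 2 ≠ 0)
    have e2 : (2 * (r : ℂ) + 1) ≠ 0 := by exact_mod_cast (by omega : 2 * r + 1 ≠ 0)
    have h2 := congrArg (C (((2 * (r : ℂ) + 2) * (2 * r + 1))⁻¹) * ·) h1
    simp only [Finset.mul_sum, ← mul_assoc, ← C_mul] at h2
    have hp : ∏ j ∈ Finset.range i,
          ((2 * ((r + (j + 1) : ℕ) : ℂ) + n) / (2 * ((r + (j + 1) : ℕ) : ℂ) + 1)) =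
        ∏ j ∈ Finset.range i,
          ((2 * ((r + 1 + j : ℕ) : ℂ) + n) / (2 * ((r + 1 + j : ℕ) : ℂ) + 1)) :=
      Finset.prod_congr rfl fun j _ => by rw [show r + (j + 1) = r + 1 + j by ring]
    have hd (k : ι) : ((2 * (r : ℂ) + 2) * (2 * r + 1))⁻¹ * dotC (a k) (a k) ^ i * (2 * r + 2) *
        (2 * r + 1) * dotC (a k) (a k) = dotC (a k) (a k) ^ (i + 1) := by
      field_simp
      ring
    simp only [hd] at h2
    rw [h2, Finset.prod_range_succ', hp, show r + 0 = r from rfl]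
    congr 2
    field_simp

/-! ### Polarization -/

lemma coeff_C_add_C_mul_X_pow (u v : ℂ) (N p : ℕ) :
    ((Polynomial.C u + Polynomial.C v * Polynomial.X) ^ N).coeff p =
      u ^ (N - p) * v ^ p * N.choose p := by
  rw [add_comm, add_pow, Polynomial.finsetSum_coeff]
  have h (l : ℕ) : ((Polynomial.C v * Polynomial.X) ^ l * Polynomial.C u ^ (N - l) *
      (N.choose l : Polynomial ℂ)).coeff p =
        if p = l then u ^ (N - l) * v ^ l * N.choose l else 0 := by
    rw [← Polynomial.C_eq_natCast, mul_pow, ← Polynomial.C_pow, ← Polynomial.C_pow,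
      Polynomial.coeff_mul_C, Polynomial.coeff_mul_C, Polynomial.coeff_C_mul,
      Polynomial.coeff_X_pow]
    split_ifs
    · ring
    · ring
  simp only [h, Finset.sum_ite_eq, Finset.mem_range]
  split_ifs with hp
  · rfl
  · rw [Nat.choose_eq_zero_of_lt (by omega)]
    simp

lemma sum_mul_dotC_pow_polarize {n : ℕ} {ι : Type*} [Fintype ι] (a : ι → Fin n → ℂ) (μ : ι → ℂ)
    (c : ℂ) (m p : ℕ) (h : ∀ x, ∑ k, μ k * dotC (a k) x ^ (2 * m) = c * dotC x x ^ m)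
    (b x : Fin n → ℂ) :
    ∑ k, μ k * (dotC (a k) x ^ (2 * m - p) * dotC (a k) b ^ p * (2 * m).choose p) =
      c * ∑ u ∈ Finset.range (m + 1), if u ≤ p then
        (2 * dotC b x) ^ (u - (p - u)) * dotC b b ^ (p - u) * u.choose (p - u) *
          (dotC x x ^ (m - u) * m.choose u) else 0 := by
  have key : ∑ k, Polynomial.C (μ k) *
        (Polynomial.C (dotC (a k) x) + Polynomial.C (dotC (a k) b) * Polynomial.X) ^ (2 * m) =
      Polynomial.C c * (Polynomial.X * (Polynomial.C (2 * dotC b x) +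
        Polynomial.C (dotC b b) * Polynomial.X) + Polynomial.C (dotC x x)) ^ m := by
    refine Polynomial.funext fun t => ?_
    have ht := h (x + t • b)
    rw [dotC_self_add_smul] at ht
    simp only [dotC_add_smul] at ht
    simp only [Polynomial.eval_finsetSum, Polynomial.eval_mul, Polynomial.eval_pow,
      Polynomial.eval_add, Polynomial.eval_C, Polynomial.eval_X]
    rw [ht, add_comm (dotC x x)]
  have := congrArg (fun f => Polynomial.coeff f p) key
  simp only [Polynomial.finsetSum_coeff, Polynomial.coeff_C_mul, coeff_C_add_C_mul_X_pow] at this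
  rw [this, add_pow, Polynomial.finsetSum_coeff]
  congr 1
  refine Finset.sum_congr rfl fun u _ => ?_
  rw [mul_pow, ← Polynomial.C_eq_natCast, ← Polynomial.C_pow, mul_assoc, ← Polynomial.C_mul,
    mul_assoc, Polynomial.coeff_X_pow_mul']
  simp only [Polynomial.coeff_mul_C, coeff_C_add_C_mul_X_pow]

/-! ### Reproducing weights -/

/-- If the weighted moments of the nodes `a k` are powers of the quadratic form, then the zonal
functions `(b · x) ^ (s - 2 * i) (b · b) ^ i (x · x) ^ i` are combinations of the functions
`∑ k, (a k · a k) ^ l (a k · b) ^ (s - 2 * l) (b · b) ^ l (a k · x) ^ s`. -/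
lemma zonal_mem_span {n s : ℕ} {ι : Type*} [Fintype ι] (a : ι → Fin n → ℂ) (c : ℕ → ℂ)
    (hc : ∀ i, c i ≠ 0)
    (h : ∀ i ≤ s, ∀ x, ∑ k, dotC (a k) (a k) ^ i * dotC (a k) x ^ (2 * (s - i)) =
      c i * dotC x x ^ (s - i)) (i : ℕ) (hi : 2 * i ≤ s) :
    (fun b x => dotC b x ^ (s - 2 * i) * dotC b b ^ i * dotC x x ^ i :
        (Fin n → ℂ) → (Fin n → ℂ) → ℂ) ∈
      Submodule.span ℂ (Set.range fun l : Fin (s / 2 + 1) =>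
        (fun b x => ∑ k, dotC (a k) (a k) ^ (l : ℕ) * dotC (a k) b ^ (s - 2 * (l : ℕ)) *
          dotC b b ^ (l : ℕ) * dotC (a k) x ^ s : (Fin n → ℂ) → (Fin n → ℂ) → ℂ)) := by
  let F : ℕ → (Fin n → ℂ) → (Fin n → ℂ) → ℂ :=
    fun l b x => dotC b x ^ (s - 2 * l) * dotC b b ^ l * dotC x x ^ l
  let G : ℕ → (Fin n → ℂ) → (Fin n → ℂ) → ℂ := fun l b x =>
    ∑ k, dotC (a k) (a k) ^ l * dotC (a k) b ^ (s - 2 * l) * dotC b b ^ l * dotC (a k) x ^ s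
  change F i ∈ Submodule.span ℂ (Set.range fun l : Fin (s / 2 + 1) => G l)
  induction hd : s - 2 * i using Nat.strong_induction_on generalizing i with
  | _ p ih =>
  subst hd
  let w : ℕ → ℂ := fun u => 2 ^ (u - (s - 2 * i - u)) * u.choose (s - 2 * i - u) *
    (s - i).choose u
  have key : ((2 * (s - i)).choose (s - 2 * i) : ℂ) • G i =
      c i • ∑ u ∈ Finset.range (s - 2 * i + 1), w u • F (s - i - u) := by
    ext b x
    have hp := sum_mul_dotC_pow_polarize a (fun k => dotC (a k) (a k) ^ i) (c i) (s - i)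
      (s - 2 * i) (h i (by omega)) b x
    rw [show 2 * (s - i) - (s - 2 * i) = s by omega, ← Finset.sum_filter,
      show (Finset.range (s - i + 1)).filter (· ≤ s - 2 * i) = Finset.range (s - 2 * i + 1) by
        ext u; simp only [Finset.mem_filter, Finset.mem_range]; omega] at hp
    simp only [Pi.smul_apply, Finset.sum_apply, smul_eq_mul, G, F]
    calc _ = (∑ k, dotC (a k) (a k) ^ i * (dotC (a k) x ^ s * dotC (a k) b ^ (s - 2 * i) *
            (2 * (s - i)).choose (s - 2 * i))) * dotC b b ^ i := by
          rw [Finset.mul_sum, Finset.sum_mul]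
          exact Finset.sum_congr rfl fun k _ => by ring
      _ = _ := by
          rw [hp, mul_assoc, Finset.sum_mul]
          congr 1
          refine Finset.sum_congr rfl fun u hu => ?_
          have hu' : u ≤ s - 2 * i := by simpa [Nat.lt_succ_iff] using hu
          rcases lt_or_ge u (s - 2 * i - u) with hlt | hge
          · simp [w, Nat.choose_eq_zero_of_lt hlt]
          · simp only [w]
            rw [show s - 2 * (s - i - u) = u - (s - 2 * i - u) by omega,
              show dotC b b ^ (s - i - u) = dotC b b ^ (s - 2 * i - u) * dotC b b ^ i by
                rw [← pow_add]; congr 1; omega]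
            ring
  have hw : w (s - 2 * i) ≠ 0 := by
    have : (s - i).choose (s - 2 * i) ≠ 0 := (Nat.choose_pos (by omega)).ne'
    simp [w, this]
  rw [Finset.sum_range_succ, show s - i - (s - 2 * i) = i by omega, smul_add] at key
  rw [← Submodule.smul_mem_iff _ hw, ← Submodule.smul_mem_iff _ (hc i), ← sub_eq_of_eq_add' key]
  refine Submodule.sub_mem _ (Submodule.smul_mem _ _ (Submodule.subset_span ?_))
    (Submodule.smul_mem _ _ (Submodule.sum_mem _ fun u hu => ?_))
  · exact ⟨⟨i, by omega⟩, rfl⟩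
  · have hu' := Finset.mem_range.1 hu
    rcases lt_or_ge u (s - 2 * i - u) with hlt | hge
    · simp [w, Nat.choose_eq_zero_of_lt hlt]
    · exact Submodule.smul_mem _ _ (ih _ (by omega) (s - i - u) (by omega) rfl)

/-- Evaluation at nodes carrying reproducing weights for forms of degree `s`, with as many nodes
as the dimension of that space, is interpolatory. -/
lemma weight_self_eq_one {n s : ℕ} {ι : Type*} [Fintype ι]
    (hcard : Fintype.card ι = (s + n - 1).choose s) (a : ι → Fin n → ℂ)
    (g : (Fin n → ℂ) → ι → ℂ)
    (h : ∀ b x, dotC b x ^ s = ∑ k, g b k * dotC (a k) x ^ s) (j : ι) : g (a j) j = 1 := by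
  classical
  have hlin (b : Fin n → ℂ) : linForm b = ∑ i, b i • (X i : MvPolynomial (Fin n) ℂ) := by
    simp [linForm, smul_eq_C_mul]
  have hmon (b : Fin n → ℂ) (α : Fin n →₀ ℕ)
      (hα : α ∈ Finset.finsuppAntidiag (Finset.univ : Finset (Fin n)) s) :
      ∏ i, b i ^ α i = ∑ k, g b k * ∏ i, a k i ^ α i := by
    have hα' : α.sum (fun _ m => m) = s := by
      rw [Finsupp.sum_fintype _ _ (fun _ => rfl)]
      simpa using hα
    have key : linForm b ^ s = ∑ k, C (g b k) * linForm (a k) ^ s :=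
      MvPolynomial.funext fun x => by simpa [eval_linForm] using h b x
    have hcoeff := congrArg (coeff α) key
    simp only [coeff_sum, coeff_C_mul, hlin, coeff_linearCombination_X_pow_of_fintype, hα',
      if_true, Finsupp.prod_fintype _ _ (fun _ => pow_zero _)] at hcoeff
    have hne : (α.multinomial : ℂ) ≠ 0 := by
      exact_mod_cast (Nat.multinomial_pos _ _).ne'
    refine mul_left_cancel₀ hne (hcoeff.trans ?_)
    rw [Finset.mul_sum]
    exact Finset.sum_congr rfl fun k _ => by ring
  have e : ι ≃ Finset.finsuppAntidiag (Finset.univ : Finset (Fin n)) s :=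
    Fintype.equivOfCardEq (by
      simp [hcard, Finset.card_finsuppAntidiag_nat_eq_choose, add_comm])
  let M : Matrix ι ι ℂ := Matrix.of fun k l => ∏ i, a k i ^ (e l).1 i
  let P : Matrix ι ι ℂ := Matrix.of fun k l => g (a k) l
  have hPM : P * M = M := by
    ext k l
    simp only [Matrix.mul_apply, P, M, Matrix.of_apply]
    exact (hmon (a k) _ (e l).2).symm
  have hM : IsUnit M := by
    rw [← Matrix.mulVec_injective_iff_isUnit]
    refine (injective_iff_map_eq_zero M.mulVecLin).2 fun v hv => ?_
    have hv' (k : ι) : ∑ l, (∏ i, a k i ^ (e l).1 i) * v l = 0 := congrFun hv k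
    have hF : ∑ l, monomial (e l).1 (v l) = (0 : MvPolynomial (Fin n) ℂ) := by
      refine MvPolynomial.funext fun b => ?_
      simp only [map_sum, eval_monomial, map_zero, Finsupp.prod_fintype _ _ (fun _ => pow_zero _)]
      calc ∑ l, v l * ∏ i, b i ^ (e l).1 i
          = ∑ l, ∑ k, g b k * ((∏ i, a k i ^ (e l).1 i) * v l) :=
            Finset.sum_congr rfl fun l _ => by
              rw [hmon b _ (e l).2, Finset.mul_sum]
              exact Finset.sum_congr rfl fun k _ => by ring
        _ = 0 := by
            rw [Finset.sum_comm]
            simp only [← Finset.mul_sum, hv', mul_zero, Finset.sum_const_zero]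
    ext l
    have := congrArg (coeff (e l).1) hF
    simpa [coeff_sum, coeff_monomial, Subtype.ext_iff.symm] using this
  have hP : P = 1 := hM.mul_right_cancel (hPM.trans (one_mul M).symm)
  have := congrFun (congrFun hP j) j
  simpa [P] using this

/-- Every tight decomposition q_n^s = Σ_{k=1}^{T_{n,s}} (a_k·x)^{2s} is first
caliber; in particular (a_k·a_k)^s = (1/T_{n,s}) · ∏_{j=0}^{s−1} (2j+n)/(2j+1) for every k. -/
theorem tight_implies_first_caliber (n s : ℕ) (hn : 1 ≤ n) (hs : 1 ≤ s)
    (a : Fin ((s + n - 1).choose s) → Fin n → ℂ)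
    (hdec : qpoly n ^ s = ∑ k, linForm (a k) ^ (2 * s)) :
    (∀ k l, (dotC (a k) (a k)) ^ s = (dotC (a l) (a l)) ^ s) ∧
      ∀ k, (dotC (a k) (a k)) ^ s =
        (1 / (((s + n - 1).choose s : ℕ) : ℂ)) *
          ∏ j ∈ Finset.range s, ((2 * (j : ℂ) + (n : ℂ)) / (2 * (j : ℂ) + 1)) := by
  let w : ℕ → ℂ := fun j => (2 * (j : ℂ) + n) / (2 * (j : ℂ) + 1)
  let c : ℕ → ℂ := fun i => ∏ j ∈ Finset.range i, w (s - i + j)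
  have hc (i : ℕ) : c i ≠ 0 := by
    refine Finset.prod_ne_zero_iff.2 fun j _ => div_ne_zero ?_ ?_
    · exact_mod_cast (by omega : 2 * (s - i + j) + n ≠ 0)
    · exact_mod_cast (by omega : 2 * (s - i + j) + 1 ≠ 0)
  have hmom (i : ℕ) (hi : i ≤ s) (x : Fin n → ℂ) :
      ∑ k, dotC (a k) (a k) ^ i * dotC (a k) x ^ (2 * (s - i)) = c i * dotC x x ^ (s - i) := by
    have := congrArg (eval x) (sum_dotC_pow_mul_linForm_pow a i (s - i)
      (by rw [Nat.sub_add_cancel hi]; exact hdec))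
    simpa only [map_sum, map_mul, map_pow, eval_C, eval_linForm, eval_qpoly] using this
  obtain ⟨γ, hγ⟩ := (Submodule.mem_span_range_iff_exists_fun ℂ).1
    (zonal_mem_span a c hc hmom 0 (by omega))
  let g : (Fin n → ℂ) → Fin ((s + n - 1).choose s) → ℂ := fun b k =>
    ∑ l : Fin (s / 2 + 1), γ l * (dotC (a k) (a k) ^ (l : ℕ) *
      dotC (a k) b ^ (s - 2 * (l : ℕ)) * dotC b b ^ (l : ℕ))
  have hg (b x : Fin n → ℂ) : dotC b x ^ s = ∑ k, g b k * dotC (a k) x ^ s := by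
    have := congrFun (congrFun hγ b) x
    simp only [Finset.sum_apply, Pi.smul_apply, smul_eq_mul, mul_zero, Nat.sub_zero, pow_zero,
      mul_one, Finset.mul_sum] at this
    rw [← this, Finset.sum_comm]
    simp only [g, Finset.sum_mul]
    exact Finset.sum_congr rfl fun k _ => Finset.sum_congr rfl fun l _ => by ring
  have hone (k) : (∑ l, γ l) * dotC (a k) (a k) ^ s = 1 := by
    rw [← weight_self_eq_one (by simp) a g hg k, Finset.sum_mul]
    refine Finset.sum_congr rfl fun l _ => ?_
    rw [← pow_add, ← pow_add]
    congr 2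
    omega
  have heq (k l) : dotC (a k) (a k) ^ s = dotC (a l) (a l) ^ s :=
    mul_left_cancel₀ (left_ne_zero_of_mul_eq_one (hone k)) ((hone k).trans (hone l).symm)
  refine ⟨heq, fun k => ?_⟩
  have hT : (((s + n - 1).choose s : ℕ) : ℂ) ≠ 0 := by
    exact_mod_cast (Nat.choose_pos (by omega)).ne'
  have hs0 := hmom s le_rfl 0
  rw [Finset.sum_congr rfl fun l _ => by rw [heq l k]] at hs0
  simp only [Nat.sub_self, mul_zero, pow_zero, mul_one, Finset.sum_const, Finset.card_univ,
    Fintype.card_fin, nsmul_eq_mul, c, zero_add, w] at hs0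
  rw [← hs0]
  field_simp
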